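/- arXiv:1710.06703 — 5 statements merged into one kernel-verified Lean document; each statement's English description precedes it below -/
import Mathlib

section
/- Define F : ℝ³ → ℝ by F(X) = Σ_{j=1}^{3} f0( f1(X₁) + f1(X₂) + f1(X₃) − j ). Then for every X ∈ ℝ³, 0 ≤ F(X) ≤ 1. -/
noncomputable def f0 (ε x : ℝ) : ℝ :=
  ε⁻¹ * (max 0 (x + ε) - 2 * max 0 x + max 0 (x - ε))

noncomputable def f1 (ε x : ℝ) : ℝ := f0 ε (x - 1)

noncomputable def F3 (ε : ℝ) (X : Fin 3 → ℝ) : ℝ :=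
  ∑ j ∈ Finset.Icc (1 : ℕ) 3, f0 ε ((∑ i, f1 ε (X i)) - (j : ℝ))

theorem f0_nonneg {ε : ℝ} (hε : 0 < ε) (x : ℝ) : 0 ≤ f0 ε x := by
  apply mul_nonneg (inv_nonneg.2 hε.le)
  rcases max_cases 0 (x + ε) with h | h <;> rcases max_cases 0 x with h' | h' <;>
    rcases max_cases 0 (x - ε) with h'' | h'' <;> linarith

theorem f0_le_one {ε : ℝ} (hε : 0 < ε) (x : ℝ) : f0 ε x ≤ 1 := by
  rw [f0, inv_mul_le_iff₀ hε]
  rcases max_cases 0 (x + ε) with h | h <;> rcases max_cases 0 x with h' | h' <;>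
    rcases max_cases 0 (x - ε) with h'' | h'' <;> linarith

theorem f0_eq_zero_of_le {ε x : ℝ} (hε : 0 < ε) (hx : ε ≤ x) : f0 ε x = 0 := by
  rw [f0, max_eq_right (by linarith), max_eq_right (by linarith), max_eq_right (by linarith)]
  ring

theorem f0_eq_zero_of_le_neg {ε x : ℝ} (hε : 0 < ε) (hx : x ≤ -ε) : f0 ε x = 0 := by
  rw [f0, max_eq_left (by linarith), max_eq_left (by linarith), max_eq_left (by linarith)]
  ring

/-- Bumps of width `ε < 1 / 2` centred at distinct integers have disjoint supports. -/
theorem sum_f0_sub_natCast_le_one {ε : ℝ} (hε : 0 < ε) (hε' : ε < 1 / 2) (x : ℝ) (s : Finset ℕ) :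
    ∑ j ∈ s, f0 ε (x - j) ≤ 1 := by
  by_cases h : ∃ j ∈ s, f0 ε (x - j) ≠ 0
  · obtain ⟨j, hj, hne⟩ := h
    have h₁ : x - j < ε := not_le.1 fun h ↦ hne (f0_eq_zero_of_le hε h)
    have h₂ : -ε < x - j := not_le.1 fun h ↦ hne (f0_eq_zero_of_le_neg hε h)
    rw [Finset.sum_eq_single_of_mem j hj]
    · exact f0_le_one hε _
    · intro k _ hkj
      rcases hkj.lt_or_gt with hk | hk
      · have : (k : ℝ) + 1 ≤ j := mod_cast hk
        exact f0_eq_zero_of_le hε (by linarith)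
      · have : (j : ℝ) + 1 ≤ k := mod_cast hk
        exact f0_eq_zero_of_le_neg hε (by linarith)
  · push Not at h
    rw [Finset.sum_eq_zero h]
    exact zero_le_one

theorem stmt2 (ε : ℝ) (hε : 0 < ε) (hε' : ε < 1 / 2) (X : Fin 3 → ℝ) :
    0 ≤ F3 ε X ∧ F3 ε X ≤ 1 :=
  ⟨Finset.sum_nonneg fun _ _ ↦ f0_nonneg hε _, sum_f0_sub_natCast_le_one hε hε' _ _⟩
end

section
/- Define F : ℝ³ → ℝ by F(X) = Σ_{j=1}^{3} f0( f1(X₁) + f1(X₂) + f1(X₃) − j ). If |X₁ − 1| < ε, |X₂ − 1| ≥ ε, and |X₃ − 1| ≥ ε, then F(X) = max(0, 1 − |X₁ − 1|/ε²). -/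
theorem f0_eq_max {ε : ℝ} (hε : 0 < ε) (x : ℝ) : f0 ε x = max 0 (1 - |x| / ε) := by
  have key : max 0 (x + ε) - 2 * max 0 x + max 0 (x - ε) = max 0 (ε - |x|) := by
    grind
  have hscale : 1 - |x| / ε = ε⁻¹ * (ε - |x|) := by field_simp
  rw [f0, key, hscale, mul_max_of_nonneg _ _ (inv_nonneg.mpr hε.le), mul_zero]

theorem f0_eq_zero {ε : ℝ} (hε : 0 < ε) {x : ℝ} (hx : ε ≤ |x|) : f0 ε x = 0 := by
  rw [f0_eq_max hε, max_eq_left]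
  exact sub_nonpos.mpr ((one_le_div hε).mpr hx)

theorem stmt4 (ε : ℝ) (hε : 0 < ε) (hε' : ε < 1 / 2) (X : Fin 3 → ℝ)
    (h1 : |X 0 - 1| < ε) (h2 : ε ≤ |X 1 - 1|) (h3 : ε ≤ |X 2 - 1|) :
    F3 ε X = max 0 (1 - |X 0 - 1| / ε ^ 2) := by
  have ht : 0 ≤ |X 0 - 1| / ε := by positivity
  have hsum : ∑ i, f1 ε (X i) = 1 - |X 0 - 1| / ε := by
    have hpos : 0 ≤ 1 - |X 0 - 1| / ε := sub_nonneg.mpr ((div_le_one hε).mpr h1.le)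
    simp only [Fin.sum_univ_three, f1]
    rw [f0_eq_zero hε h2, f0_eq_zero hε h3, f0_eq_max hε, max_eq_right hpos, add_zero, add_zero]
  have hfar (j : ℝ) (hj : 2 ≤ j) : f0 ε (1 - |X 0 - 1| / ε - j) = 0 := by
    apply f0_eq_zero hε
    rw [abs_of_nonpos (by linarith)]
    linarith
  have hIcc : Finset.Icc (1 : ℕ) 3 = {1, 2, 3} := rfl
  rw [F3, hsum, hIcc, Finset.sum_insert (by decide), Finset.sum_pair (by decide),
    hfar (2 : ℕ) (by norm_num), hfar (3 : ℕ) (by norm_num), add_zero, add_zero, f0_eq_max hε,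
    Nat.cast_one, sub_sub_cancel_left, abs_neg, abs_of_nonneg ht, div_div, pow_two]
end

section
/- If a ∈ {0,1}^p is a Boolean assignment satisfying the 3-CNF formula φ, then f_φ(x_a) = 1, where x_a ∈ ℝ^p is the real embedding of a. -/
open MeasureTheory

/-- A literal over `p` Boolean variables: a variable index and a polarity. -/
structure Lit (p : ℕ) where
  idx : Fin p
  pos : Bool

/-- Value of a literal on a real input: `f1` for a positive literal, `f0` for a negated one. -/
noncomputable def litVal (ε : ℝ) {p : ℕ} (L : Lit p) (x : Fin p → ℝ) : ℝ :=
  if L.pos then f1 ε (x L.idx) else f0 ε (x L.idx)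

/-- Clause function `g_j(x) = Σ_{k=1}^{3} f0(ℓ₁(x) + ℓ₂(x) + ℓ₃(x) − k)`. -/
noncomputable def clauseVal (ε : ℝ) {p : ℕ} (C : Fin 3 → Lit p) (x : Fin p → ℝ) : ℝ :=
  ∑ k ∈ Finset.Icc (1 : ℕ) 3, f0 ε ((∑ t, litVal ε (C t) x) - (k : ℝ))

/-- Formula function `f_φ(x) = f0(Σ_{j=1}^{c} g_j(x) − c)`. -/
noncomputable def cnfVal (ε : ℝ) {p c : ℕ} (φ : Fin c → Fin 3 → Lit p) (x : Fin p → ℝ) : ℝ :=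
  f0 ε ((∑ j, clauseVal ε (φ j) x) - (c : ℝ))

/-- A Boolean assignment satisfies `φ` if every clause has a true literal. -/
def Satisfies {p c : ℕ} (a : Fin p → Bool) (φ : Fin c → Fin 3 → Lit p) : Prop :=
  ∀ j, ∃ t, a (φ j t).idx = (φ j t).pos

/-- Real embedding of a Boolean assignment. -/
noncomputable def embed {p : ℕ} (a : Fin p → Bool) : Fin p → ℝ :=
  fun i => if a i then 1 else 0

theorem f0_zero {ε : ℝ} (hε : 0 < ε) : f0 ε 0 = 1 := by
  simp [f0, hε.le, hε.ne']

theorem f0_eq_zero_of_le_abs {ε x : ℝ} (hε : 0 < ε) (hx : ε ≤ |x|) : f0 ε x = 0 := by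
  unfold f0
  rcases le_abs'.mp hx with h | h
  · rw [max_eq_left (by linarith), max_eq_left (by linarith), max_eq_left (by linarith)]
    ring
  · rw [max_eq_right (by linarith), max_eq_right (by linarith), max_eq_right (by linarith)]
    ring

theorem f0_intCast {ε : ℝ} (hε : 0 < ε) (hε' : ε < 1 / 2) (n : ℤ) :
    f0 ε n = if n = 0 then 1 else 0 := by
  split_ifs with h
  · rw [h, Int.cast_zero, f0_zero hε]
  · refine f0_eq_zero_of_le_abs hε ?_
    have : (1 : ℝ) ≤ |(n : ℝ)| := by exact_mod_cast Int.one_le_abs h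
    linarith

/-- On a Boolean point, the value of a literal is its truth value. -/
theorem litVal_embed {ε : ℝ} (hε : 0 < ε) (hε' : ε < 1 / 2) {p : ℕ} (L : Lit p)
    (a : Fin p → Bool) : litVal ε L (embed a) = if a L.idx = L.pos then 1 else 0 := by
  have h0 := f0_zero hε
  have h1 : f0 ε 1 = 0 := f0_eq_zero_of_le_abs hε (by rw [abs_one]; linarith)
  have hn : f0 ε (-1) = 0 := f0_eq_zero_of_le_abs hε (by rw [abs_neg, abs_one]; linarith)
  cases hp : L.pos <;> cases ha : a L.idx <;> simp [litVal, f1, embed, hp, ha, h0, h1, hn]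

/-- A clause with a true literal takes the value `1` on the embedded assignment. -/
theorem clauseVal_embed {ε : ℝ} (hε : 0 < ε) (hε' : ε < 1 / 2) {p : ℕ} (C : Fin 3 → Lit p)
    (a : Fin p → Bool) (h : ∃ t, a (C t).idx = (C t).pos) : clauseVal ε C (embed a) = 1 := by
  set s := Finset.univ.filter fun t => a (C t).idx = (C t).pos with hs
  have hsum : ∑ t, litVal ε (C t) (embed a) = (s.card : ℝ) := by
    simp [litVal_embed hε hε', hs]
  have hmem : s.card ∈ Finset.Icc 1 3 := by
    obtain ⟨t, ht⟩ := h
    exact Finset.mem_Icc.mpr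
      ⟨Finset.card_pos.mpr ⟨t, by simp [hs, ht]⟩, by simpa using s.card_le_univ⟩
  have hterm (k : ℕ) : f0 ε ((s.card : ℝ) - k) = if s.card = k then 1 else 0 := by
    have := f0_intCast hε hε' ((s.card : ℤ) - k)
    push_cast at this
    simpa [sub_eq_zero] using this
  rw [clauseVal, hsum, Finset.sum_congr rfl fun k _ => hterm k, Finset.sum_ite_eq, if_pos hmem]

theorem stmt7 (ε : ℝ) (hε : 0 < ε) (hε' : ε < 1 / 2)
    (p c : ℕ) (φ : Fin c → Fin 3 → Lit p) (a : Fin p → Bool) (ha : Satisfies a φ) :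
    cnfVal ε φ (embed a) = 1 := by
  simp [cnfVal, fun j => clauseVal_embed hε hε' (φ j) a (ha j), f0_zero hε]
end

section
/- Let P and Q be probability measures on a measurable space Ω with P absolutely continuous with respect to Q, let ρ = dP/dQ, and let f : Ω → ℝ^s be measurable. Suppose ∫ ‖f‖₂² dQ ≤ A, the variance of ω ↦ ‖f(ω)‖₂² under Q is at most B² (with A, B ≥ 0), and D := ∫ ρ dP < ∞. Then ∫ ‖f‖₂² dP ≤ (A + B)·D^{1/2}; in particular the variance of ω ↦ ‖f(ω)‖₂ under P is at most (A + B)·D^{1/2}. -/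
open MeasureTheory

/-- Cauchy-Schwarz change of measure: the `P`-integral of `g` is controlled by the second moments
of `dP/dQ` and of `g` under `Q`. -/
theorem lintegral_le_rnDeriv_mul_sq {Ω : Type*} [MeasurableSpace Ω]
    (P Q : Measure Ω) [SigmaFinite P] [SigmaFinite Q] (hPQ : P ≪ Q)
    {g : Ω → ENNReal} (hg : Measurable g) :
    ∫⁻ ω, g ω ∂P ≤
      (∫⁻ ω, P.rnDeriv Q ω ∂P) ^ (1 / 2 : ℝ) * (∫⁻ ω, g ω ^ 2 ∂Q) ^ (1 / 2 : ℝ) := by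
  have hρ := Measure.measurable_rnDeriv P Q
  rw [← lintegral_rnDeriv_mul hPQ hg.aemeasurable, ← lintegral_rnDeriv_mul hPQ hρ.aemeasurable]
  have h := ENNReal.lintegral_mul_le_Lp_mul_Lq Q Real.HolderConjugate.two_two
    hρ.aemeasurable hg.aemeasurable
  simpa only [Pi.mul_apply, ENNReal.rpow_two, pow_two] using h

theorem stmt17 {Ω : Type*} [MeasurableSpace Ω]
    (P Q : Measure Ω) [IsProbabilityMeasure P] [IsProbabilityMeasure Q]
    (hPQ : P ≪ Q) (s : ℕ)
    (f : Ω → EuclideanSpace ℝ (Fin s)) (hf : Measurable f)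
    (ρ : Ω → ENNReal) (hρ : ρ = P.rnDeriv Q)
    (A B D : ℝ) (hA : 0 ≤ A) (hB : 0 ≤ B) (hD : 0 ≤ D)
    (hQA : ∫⁻ ω, (‖f ω‖₊ : ENNReal) ^ 2 ∂Q ≤ ENNReal.ofReal A)
    (hQB : (∫⁻ ω, (‖f ω‖₊ : ENNReal) ^ 4 ∂Q) -
        (∫⁻ ω, (‖f ω‖₊ : ENNReal) ^ 2 ∂Q) ^ 2 ≤ ENNReal.ofReal (B ^ 2))
    (hDval : ∫⁻ ω, ρ ω ∂P = ENNReal.ofReal D) :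
    (∫⁻ ω, (‖f ω‖₊ : ENNReal) ^ 2 ∂P ≤ ENNReal.ofReal ((A + B) * Real.sqrt D)) ∧
    (∫⁻ ω, (‖f ω‖₊ : ENNReal) ^ 2 ∂P) - (∫⁻ ω, (‖f ω‖₊ : ENNReal) ∂P) ^ 2 ≤
      ENNReal.ofReal ((A + B) * Real.sqrt D) := by
  have hnorm : Measurable fun ω => (‖f ω‖₊ : ENNReal) := by fun_prop
  have h4 : ∫⁻ ω, ((‖f ω‖₊ : ENNReal) ^ 2) ^ 2 ∂Q ≤ ENNReal.ofReal (A + B) ^ 2 := by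
    simp only [← pow_mul]
    calc ∫⁻ ω, (‖f ω‖₊ : ENNReal) ^ 4 ∂Q
        ≤ ENNReal.ofReal (B ^ 2) + (∫⁻ ω, (‖f ω‖₊ : ENNReal) ^ 2 ∂Q) ^ 2 :=
          tsub_le_iff_right.mp hQB
      _ ≤ ENNReal.ofReal (B ^ 2) + ENNReal.ofReal A ^ 2 := by gcongr
      _ = ENNReal.ofReal (B ^ 2 + A ^ 2) := by
          rw [← ENNReal.ofReal_pow hA, ENNReal.ofReal_add (sq_nonneg B) (sq_nonneg A)]
      _ ≤ ENNReal.ofReal (A + B) ^ 2 := by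
          rw [← ENNReal.ofReal_pow (add_nonneg hA hB)]
          exact ENNReal.ofReal_le_ofReal (by nlinarith [mul_nonneg hA hB])
  have key : ∫⁻ ω, (‖f ω‖₊ : ENNReal) ^ 2 ∂P ≤ ENNReal.ofReal ((A + B) * Real.sqrt D) := by
    subst hρ
    calc ∫⁻ ω, (‖f ω‖₊ : ENNReal) ^ 2 ∂P
        ≤ (∫⁻ ω, P.rnDeriv Q ω ∂P) ^ (1 / 2 : ℝ) *
            (∫⁻ ω, ((‖f ω‖₊ : ENNReal) ^ 2) ^ 2 ∂Q) ^ (1 / 2 : ℝ) :=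
          lintegral_le_rnDeriv_mul_sq P Q hPQ (hnorm.pow_const 2)
      _ ≤ ENNReal.ofReal D ^ (1 / 2 : ℝ) * (ENNReal.ofReal (A + B) ^ 2) ^ (1 / 2 : ℝ) := by
          rw [hDval]
          gcongr
      _ = ENNReal.ofReal ((A + B) * Real.sqrt D) := by
          rw [← ENNReal.rpow_two, ← ENNReal.rpow_mul, ENNReal.ofReal_rpow_of_nonneg hD (by norm_num),
            ← Real.sqrt_eq_rpow, ENNReal.ofReal_mul (add_nonneg hA hB), mul_comm]
          norm_num
  exact ⟨key, tsub_le_self.trans key⟩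
end

section
/- Let P and Q be probability measures on a measurable space Ω with P absolutely continuous with respect to Q, let ρ = dP/dQ, and let f : Ω → ℝ^s be measurable. Suppose ∫ ‖f‖₂² dQ ≤ A, the variance of ω ↦ ‖f(ω)‖₂² under Q is at most B² (with A, B ≥ 0), and D := ∫ ρ dP < ∞. Then for every δ ∈ (0,1), P( { x : ‖f(x)‖₂ > (A+B)^{1/2}·D^{1/4}/√δ + A^{1/2}·D^{1/2} } ) ≤ δ. -/
open MeasureTheory

/-- Change of measure by the Cauchy-Schwarz inequality: the `P`-integral of `g` is controlled by
the second moment of `g` under `Q` and by `∫⁻ dP/dQ ∂P`. -/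
theorem lintegral_le_rpow_half_mul_rpow_half {Ω : Type*} [MeasurableSpace Ω]
    (P Q : Measure Ω) [SigmaFinite P] [SigmaFinite Q] (hPQ : P ≪ Q)
    {g : Ω → ENNReal} (hg : Measurable g) :
    ∫⁻ ω, g ω ∂P ≤
      (∫⁻ ω, P.rnDeriv Q ω ∂P) ^ ((1 : ℝ) / 2) * (∫⁻ ω, g ω ^ 2 ∂Q) ^ ((1 : ℝ) / 2) := by
  have hρ : Measurable (P.rnDeriv Q) := Measure.measurable_rnDeriv P Q
  rw [← lintegral_rnDeriv_mul hPQ hg.aemeasurable, ← lintegral_rnDeriv_mul hPQ hρ.aemeasurable]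
  have h := ENNReal.lintegral_mul_le_Lp_mul_Lq Q Real.HolderConjugate.two_two
    hρ.aemeasurable hg.aemeasurable
  simpa only [Pi.mul_apply, ENNReal.rpow_two, sq (P.rnDeriv Q _)] using h

/-- Markov's inequality with the level set at `c / δ`, including the degenerate case `c = 0`. -/
theorem meas_lt_le_of_lintegral_le {Ω : Type*} [MeasurableSpace Ω] (P : Measure Ω)
    {g : Ω → ENNReal} (hg : Measurable g) {c δ : ℝ} (hc : 0 ≤ c) (hδ : 0 < δ)
    (h : ∫⁻ ω, g ω ∂P ≤ ENNReal.ofReal c) :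
    P {ω | ENNReal.ofReal (c / δ) < g ω} ≤ ENNReal.ofReal δ := by
  rcases hc.eq_or_lt with rfl | hc
  · have h0 : ∫⁻ ω, g ω ∂P = 0 := by simpa using h
    rw [lintegral_eq_zero_iff hg] at h0
    have : P {ω | ENNReal.ofReal (0 / δ) < g ω} = 0 := by
      refine measure_mono_null (fun ω hω => ?_) (ae_iff.mp h0)
      simpa [pos_iff_ne_zero] using hω
    exact this.le.trans zero_le
  · have hpos : 0 < c / δ := div_pos hc hδ
    calc P {ω | ENNReal.ofReal (c / δ) < g ω}
        ≤ P {ω | ENNReal.ofReal (c / δ) ≤ g ω} := measure_mono (Set.ofPred_subset_ofPred.mpr fun _ => le_of_lt)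
      _ ≤ (∫⁻ ω, g ω ∂P) / ENNReal.ofReal (c / δ) :=
        meas_ge_le_lintegral_div hg.aemeasurable (by simpa using hpos) ENNReal.ofReal_ne_top
      _ ≤ ENNReal.ofReal c / ENNReal.ofReal (c / δ) := by gcongr
      _ = ENNReal.ofReal δ := by
        rw [← ENNReal.ofReal_div_of_pos hpos, div_div_cancel₀ hc.ne']

theorem stmt18 {Ω : Type*} [MeasurableSpace Ω]
    (P Q : Measure Ω) [IsProbabilityMeasure P] [IsProbabilityMeasure Q]
    (hPQ : P ≪ Q) (s : ℕ)
    (f : Ω → EuclideanSpace ℝ (Fin s)) (hf : Measurable f)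
    (ρ : Ω → ENNReal) (hρ : ρ = P.rnDeriv Q)
    (A B D : ℝ) (hA : 0 ≤ A) (hB : 0 ≤ B) (hD : 0 ≤ D)
    (hQA : ∫⁻ ω, (‖f ω‖₊ : ENNReal) ^ 2 ∂Q ≤ ENNReal.ofReal A)
    (hQB : (∫⁻ ω, (‖f ω‖₊ : ENNReal) ^ 4 ∂Q) -
        (∫⁻ ω, (‖f ω‖₊ : ENNReal) ^ 2 ∂Q) ^ 2 ≤ ENNReal.ofReal (B ^ 2))
    (hDval : ∫⁻ ω, ρ ω ∂P = ENNReal.ofReal D)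
    (δ : ℝ) (hδ0 : 0 < δ) (hδ1 : δ < 1) :
    P {x | Real.sqrt (A + B) * D ^ ((1 : ℝ) / 4) / Real.sqrt δ +
          Real.sqrt A * Real.sqrt D < ‖f x‖} ≤ ENNReal.ofReal δ := by
  subst hρ
  have hAB : 0 ≤ A + B := add_nonneg hA hB
  have hg : Measurable fun ω => (‖f ω‖₊ : ENNReal) ^ 2 := by fun_prop
  have fourth : ∫⁻ ω, ((‖f ω‖₊ : ENNReal) ^ 2) ^ 2 ∂Q ≤ ENNReal.ofReal ((A + B) ^ 2) := by
    simp only [← pow_mul]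
    calc ∫⁻ ω, (‖f ω‖₊ : ENNReal) ^ 4 ∂Q
        ≤ ENNReal.ofReal (B ^ 2) + (∫⁻ ω, (‖f ω‖₊ : ENNReal) ^ 2 ∂Q) ^ 2 :=
          tsub_le_iff_right.mp hQB
      _ ≤ ENNReal.ofReal (B ^ 2) + ENNReal.ofReal A ^ 2 := by gcongr
      _ = ENNReal.ofReal (B ^ 2 + A ^ 2) := by
          rw [← ENNReal.ofReal_pow hA, ENNReal.ofReal_add (by positivity) (by positivity)]
      _ ≤ ENNReal.ofReal ((A + B) ^ 2) := by
          apply ENNReal.ofReal_le_ofReal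
          nlinarith [mul_nonneg hA hB]
  have second : ∫⁻ ω, (‖f ω‖₊ : ENNReal) ^ 2 ∂P ≤ ENNReal.ofReal (√D * (A + B)) := by
    calc ∫⁻ ω, (‖f ω‖₊ : ENNReal) ^ 2 ∂P
        ≤ ENNReal.ofReal D ^ ((1 : ℝ) / 2) * ENNReal.ofReal ((A + B) ^ 2) ^ ((1 : ℝ) / 2) := by
          refine (lintegral_le_rpow_half_mul_rpow_half P Q hPQ hg).trans ?_
          rw [hDval]
          gcongr
      _ = ENNReal.ofReal (√D * (A + B)) := by
          rw [ENNReal.ofReal_rpow_of_nonneg hD (by norm_num),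
            ENNReal.ofReal_rpow_of_nonneg (by positivity) (by norm_num),
            ← Real.sqrt_eq_rpow, ← Real.sqrt_eq_rpow, Real.sqrt_sq hAB,
            ← ENNReal.ofReal_mul (by positivity)]
  refine (measure_mono fun x hx => ?_).trans
    (meas_lt_le_of_lintegral_le P hg (by positivity) hδ0 second)
  have hsq : (√(A + B) * D ^ ((1 : ℝ) / 4) / √δ) ^ 2 = √D * (A + B) / δ := by
    rw [div_pow, mul_pow, Real.sq_sqrt hAB, Real.sq_sqrt hδ0.le, ← Real.rpow_mul_natCast hD,
      Real.sqrt_eq_rpow]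
    norm_num [mul_comm]
  have hlt : √(A + B) * D ^ ((1 : ℝ) / 4) / √δ < ‖f x‖ :=
    lt_of_le_of_lt (le_add_of_nonneg_right (by positivity)) hx
  have hnorm : (‖f x‖₊ : ENNReal) ^ 2 = ENNReal.ofReal (‖f x‖ ^ 2) := by
    rw [ENNReal.ofReal_pow (norm_nonneg _), ofReal_norm, enorm_eq_nnnorm]
  rw [Set.mem_ofPred_eq, hnorm, ← hsq]
  have hlt2 := pow_lt_pow_left₀ hlt (by positivity) two_ne_zero
  exact (ENNReal.ofReal_lt_ofReal_iff_of_nonneg (by positivity)).mpr hlt2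
end
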